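/- For every integer n ≥ 4 there exist a simple polygon P with n vertices and two points s and t in the interior of P such that every diffuse reflection path in P from s to t has at least ⌊n/2⌋ − 1 reflections. (Consequently the bound ⌊n/2⌋ − 1 on the number of diffuse reflections needed to illuminate a simple polygon with n walls is tight.) -/

import Mathlib

open Set

/-- The plane ℝ². -/
abbrev Plane := EuclideanSpace ℝ (Fin 2)

/-- The `i`-th edge of a polygon with vertices `v 0, …, v (n-1)`:
the segment from `v i` to `v ((i+1) % n)`. -/
def polyEdge (n : ℕ) (v : ℕ → Plane) (i : ℕ) : Set Plane :=
  segment ℝ (v i) (v ((i + 1) % n))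

/-- `P` is a simple polygon with vertices `v 0, …, v (n-1)`: a compact set with
nonempty connected interior whose frontier is the union of the `n` edges; the
vertices are pairwise distinct, consecutive edges meet exactly in their common
vertex, and non-consecutive edges are disjoint. -/
def IsSimplePolygon (n : ℕ) (P : Set Plane) (v : ℕ → Plane) : Prop :=
  IsCompact P ∧ IsConnected (interior P) ∧
  (∀ i < n, ∀ j < n, v i = v j → i = j) ∧
  (frontier P = ⋃ i ∈ Finset.range n, polyEdge n v i) ∧
  (∀ i < n, ∀ j < n, i ≠ j →
    (j = (i + 1) % n → polyEdge n v i ∩ polyEdge n v j = {v j}) ∧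
    (i = (j + 1) % n → polyEdge n v i ∩ polyEdge n v j = {v i}) ∧
    (j ≠ (i + 1) % n → i ≠ (j + 1) % n →
      Disjoint (polyEdge n v i) (polyEdge n v j)))

/-- A diffuse reflection path in `P` from `s` to `t` with `m` segments
(`m - 1` reflections), given by the points `p 0 = s, p 1, …, p m = t`:
all points lie in `P`, every intermediate point lies in the relative interior
(open segment) of some edge of `P`, and the relative interior of each segment
of the path lies in the interior of `P`. -/
def IsDiffusePath (n : ℕ) (P : Set Plane) (v : ℕ → Plane)
    (s t : Plane) (m : ℕ) (p : ℕ → Plane) : Prop :=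
  p 0 = s ∧ p m = t ∧ (∀ i ≤ m, p i ∈ P) ∧
  (∀ i, 0 < i → i < m → ∃ j < n, p i ∈ openSegment ℝ (v j) (v ((j + 1) % n))) ∧
  (∀ i < m, openSegment ℝ (p i) (p (i + 1)) ⊆ interior P)

/-- `Vis n P v s k` is `V_k(s)`: the set of points `t ∈ P` reachable from `s`
by a diffuse reflection path with at most `k` reflections. -/
def Vis (n : ℕ) (P : Set Plane) (v : ℕ → Plane) (s : Plane) (k : ℕ) : Set Plane :=
  {t | t ∈ P ∧ ∃ m, m - 1 ≤ k ∧ ∃ p : ℕ → Plane, IsDiffusePath n P v s t m p}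

/-- The planar region between the graphs of `f` and `g` over `[a, b]`. -/
def graphRegion (f g : ℝ → ℝ) (a b : ℝ) : Set Plane :=
  {z | z 0 ∈ Icc a b ∧ f (z 0) ≤ z 1 ∧ z 1 ≤ g (z 0)}

/-- The point of the graph of `f` with abscissa `x`. -/
def graphPoint (f : ℝ → ℝ) (x : ℝ) : Plane := !₂[x, f x]

/-- `f` agrees with an affine function on `[p, q]`. -/
def IsAffineOnIcc (f : ℝ → ℝ) (p q : ℝ) : Prop :=
  ∃ c d : ℝ, ∀ x ∈ Icc p q, f x = c * x + d

lemma plane_ext {z w : Plane} (h0 : z 0 = w 0) (h1 : z 1 = w 1) : z = w := by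
  ext i
  fin_cases i
  · exact h0
  · exact h1

@[simp] lemma graphPoint_zero (f : ℝ → ℝ) (x : ℝ) : graphPoint f x 0 = x := by
  simp [graphPoint]

@[simp] lemma graphPoint_one (f : ℝ → ℝ) (x : ℝ) : graphPoint f x 1 = f x := by
  simp [graphPoint]

lemma IsAffineOnIcc.mono {f : ℝ → ℝ} {p q p' q' : ℝ} (h : IsAffineOnIcc f p q)
    (hp : p ≤ p') (hq : q' ≤ q) : IsAffineOnIcc f p' q' := by
  obtain ⟨c, d, h⟩ := h
  exact ⟨c, d, fun x hx => h x ⟨hp.trans hx.1, hx.2.trans hq⟩⟩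

lemma IsAffineOnIcc.add {f g : ℝ → ℝ} {p q : ℝ} (hf : IsAffineOnIcc f p q)
    (hg : IsAffineOnIcc g p q) : IsAffineOnIcc (fun x => f x + g x) p q := by
  obtain ⟨c, d, hf⟩ := hf
  obtain ⟨c', d', hg⟩ := hg
  refine ⟨c + c', d + d', fun x hx => ?_⟩
  simp only [hf x hx, hg x hx]
  ring

lemma mem_segment_graphPoint {f : ℝ → ℝ} {p q : ℝ} (hpq : p < q)
    (hf : IsAffineOnIcc f p q) (z : Plane) :
    z ∈ segment ℝ (graphPoint f p) (graphPoint f q) ↔ z 0 ∈ Icc p q ∧ z 1 = f (z 0) := by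
  obtain ⟨c, d, hf⟩ := hf
  have hp := hf p ⟨le_rfl, hpq.le⟩
  have hq := hf q ⟨hpq.le, le_rfl⟩
  have hne : q - p ≠ 0 := by linarith
  constructor
  · rintro ⟨s, t, hs, ht, hst, rfl⟩
    have hx : s * p + t * q ∈ Icc p q :=
      convex_Icc p q ⟨le_rfl, hpq.le⟩ ⟨hpq.le, le_rfl⟩ hs ht hst
    simp only [PiLp.add_apply, PiLp.smul_apply, graphPoint_zero, graphPoint_one, smul_eq_mul]
    refine ⟨hx, ?_⟩
    rw [hf _ hx, hp, hq]
    linear_combination d * hst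
  · rintro ⟨hz, hz1⟩
    refine ⟨(q - z 0) / (q - p), (z 0 - p) / (q - p),
      div_nonneg (by linarith [hz.2]) (by linarith), div_nonneg (by linarith [hz.1]) (by linarith),
      by field_simp; ring, ?_⟩
    apply plane_ext
    · simp only [PiLp.add_apply, PiLp.smul_apply, graphPoint_zero, smul_eq_mul]
      field_simp
      ring
    · simp only [PiLp.add_apply, PiLp.smul_apply, graphPoint_one, smul_eq_mul]
      rw [hz1, hf _ hz, hp, hq]
      field_simp
      ring

lemma continuous_coord (i : Fin 2) : Continuous fun z : Plane => z i := by fun_prop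

lemma interior_graphRegion {f g : ℝ → ℝ} {a b : ℝ} (hf : Continuous f) (hg : Continuous g)
    (ha : f a = g a) (hb : f b = g b) :
    interior (graphRegion f g a b) =
      {z | z 0 ∈ Ioo a b ∧ f (z 0) < z 1 ∧ z 1 < g (z 0)} := by
  apply Subset.antisymm
  · intro z hz
    have hcont : Continuous fun e : ℝ => z + e • graphPoint 1 0 := by fun_prop
    have hnear : ∀ᶠ e in nhds (0 : ℝ), z + e • graphPoint 1 0 ∈ graphRegion f g a b := by
      apply hcont.continuousAt.eventually
      simpa using mem_interior_iff_mem_nhds.1 hz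
    obtain ⟨r, hr, hball⟩ := Metric.eventually_nhds_iff.1 hnear
    have hup := hball (y := r / 2) (by simp [abs_of_pos hr]; linarith)
    have hdown := hball (y := -(r / 2)) (by simp [abs_of_pos hr]; linarith)
    simp only [graphRegion, mem_ofPred_eq, PiLp.add_apply, PiLp.smul_apply, graphPoint_zero,
      graphPoint_one, smul_eq_mul, mul_zero, add_zero, Pi.one_apply, mul_one] at hup hdown
    obtain ⟨hx, -, hup⟩ := hup
    obtain ⟨-, hdown, -⟩ := hdown
    have h1 : f (z 0) < z 1 := by linarith
    have h2 : z 1 < g (z 0) := by linarith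
    refine ⟨⟨lt_of_le_of_ne hx.1 ?_, lt_of_le_of_ne hx.2 ?_⟩, h1, h2⟩
    · intro h
      rw [← h] at h1 h2
      linarith
    · intro h
      rw [h] at h1 h2
      linarith
  · apply interior_maximal
    · rintro z ⟨⟨h1, h2⟩, h3, h4⟩
      exact ⟨⟨h1.le, h2.le⟩, h3.le, h4.le⟩
    · have hf' : Continuous fun z : Plane => f (z 0) := hf.comp (continuous_coord 0)
      have hg' : Continuous fun z : Plane => g (z 0) := hg.comp (continuous_coord 0)
      exact (isOpen_Ioo.preimage (continuous_coord 0)).inter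
        ((isOpen_lt hf' (continuous_coord 1)).inter (isOpen_lt (continuous_coord 1) hg'))

lemma continuous_interpolation {f g : ℝ → ℝ} (hf : Continuous f) (hg : Continuous g) :
    Continuous fun w : ℝ × ℝ =>
      (!₂[w.1, f w.1 + w.2 * (g w.1 - f w.1)] : Plane) := by
  apply (PiLp.continuous_toLp 2 (fun _ : Fin 2 => ℝ)).comp
  refine continuous_pi fun i => ?_
  fin_cases i
  · exact continuous_fst
  · change Continuous fun w : ℝ × ℝ => f w.1 + w.2 * (g w.1 - f w.1)
    fun_prop

lemma isCompact_graphRegion {f g : ℝ → ℝ} {a b : ℝ} (hf : Continuous f) (hg : Continuous g) :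
    IsCompact (graphRegion f g a b) := by
  have himage : IsCompact ((fun w : ℝ × ℝ =>
      (!₂[w.1, f w.1 + w.2 * (g w.1 - f w.1)] : Plane)) '' (Icc a b ×ˢ Icc 0 1)) :=
    (isCompact_Icc.prod isCompact_Icc).image (continuous_interpolation hf hg)
  apply himage.of_isClosed_subset
  · have hf' : Continuous fun z : Plane => f (z 0) := hf.comp (continuous_coord 0)
    have hg' : Continuous fun z : Plane => g (z 0) := hg.comp (continuous_coord 0)
    exact (isClosed_Icc.preimage (continuous_coord 0)).inter
      ((isClosed_le hf' (continuous_coord 1)).inter (isClosed_le (continuous_coord 1) hg'))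
  · rintro z ⟨hx, h1, h2⟩
    rcases (h1.trans h2).eq_or_lt with h | h
    · refine ⟨(z 0, 0), ⟨hx, by simp⟩, plane_ext (by simp) ?_⟩
      simp
      linarith
    · have hpos : 0 < g (z 0) - f (z 0) := by linarith
      refine ⟨(z 0, (z 1 - f (z 0)) / (g (z 0) - f (z 0))), ⟨hx, ?_, ?_⟩,
        plane_ext (by simp) ?_⟩
      · exact div_nonneg (by linarith) hpos.le
      · exact (div_le_one hpos).2 (by linarith)
      · simp
        field_simp
        ring

lemma isConnected_open_graphRegion {f g : ℝ → ℝ} {a b : ℝ} (hf : Continuous f)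
    (hg : Continuous g) (hab : a < b) (hlt : ∀ x ∈ Ioo a b, f x < g x) :
    IsConnected {z : Plane | z 0 ∈ Ioo a b ∧ f (z 0) < z 1 ∧ z 1 < g (z 0)} := by
  have hconn : IsConnected (Ioo a b ×ˢ Ioo (0 : ℝ) 1) :=
    (isConnected_Ioo hab).prod (isConnected_Ioo one_pos)
  convert hconn.image _ (continuous_interpolation hf hg).continuousOn using 1
  ext z
  constructor
  · rintro ⟨hx, h1, h2⟩
    have hpos : 0 < g (z 0) - f (z 0) := by linarith
    refine ⟨(z 0, (z 1 - f (z 0)) / (g (z 0) - f (z 0))), ⟨hx, ?_, ?_⟩, plane_ext (by simp) ?_⟩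
    · exact div_pos (by linarith) hpos
    · exact (div_lt_one hpos).2 (by linarith)
    · simp
      field_simp
      ring
  · rintro ⟨⟨x, t⟩, ⟨hx, ht0, ht1⟩, rfl⟩
    have hpos : 0 < g x - f x := sub_pos.2 (hlt x hx)
    simp only [mem_ofPred_eq, Matrix.cons_val_zero, Matrix.cons_val_one]
    refine ⟨hx, ?_, ?_⟩
    · nlinarith [mul_pos ht0 hpos]
    · nlinarith [mul_pos (sub_pos.2 ht1) hpos]

lemma exists_mem_Icc_of_chain (l : ℕ → ℝ) (N : ℕ) (hN : 1 ≤ N) {x : ℝ}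
    (hx : x ∈ Icc (l 0) (l N)) : ∃ i < N, x ∈ Icc (l i) (l (i + 1)) := by
  induction N, hN using Nat.le_induction with
  | base => exact ⟨0, one_pos, hx⟩
  | succ N hN ih =>
    rcases le_total x (l N) with h | h
    · obtain ⟨i, hi, hxi⟩ := ih ⟨hx.1, h⟩
      exact ⟨i, by omega, hxi⟩
    · exact ⟨N, by omega, h, hx.2⟩

/-- Vertices of the polygon bounded below by the graph of `f`, with breakpoints `l 0, …, l N`,
and above by the graph of `g`, with breakpoints `u 0, …, u (n - N)`. -/
noncomputable def chainVertex (f g : ℝ → ℝ) (l u : ℕ → ℝ) (N n i : ℕ) : Plane :=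
  if i ≤ N then graphPoint f (l i) else graphPoint g (u (n - i))

lemma isSimplePolygon_graphRegion {f g : ℝ → ℝ} {a b : ℝ} {l u : ℕ → ℝ} {N M : ℕ}
    (hf : Continuous f) (hg : Continuous g) (ha : f a = g a) (hb : f b = g b)
    (hlt : ∀ x ∈ Ioo a b, f x < g x) (hN : 1 ≤ N) (hM : 1 ≤ M) (hNM : 3 ≤ N + M)
    (hl : StrictMono l) (hu : StrictMono u) (hl0 : l 0 = a) (hlN : l N = b)
    (hu0 : u 0 = a) (huM : u M = b)
    (hfl : ∀ i < N, IsAffineOnIcc f (l i) (l (i + 1)))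
    (hgu : ∀ i < M, IsAffineOnIcc g (u i) (u (i + 1))) :
    IsSimplePolygon (N + M) (graphRegion f g a b) (chainVertex f g l u N (N + M)) := by
  set v := chainVertex f g l u N (N + M) with hv
  have hab : a < b := by rw [← hl0, ← hlN]; exact hl (by omega)
  have hle : ∀ x ∈ Icc a b, f x ≤ g x := by
    intro x hx
    rcases hx.1.eq_or_lt with h | h
    · exact (h ▸ ha).le
    rcases hx.2.eq_or_lt with h' | h'
    · exact (h' ▸ hb).le
    exact (hlt x ⟨h, h'⟩).le
  have hends : ∀ x ∈ Icc a b, f x = g x → x = a ∨ x = b := by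
    intro x hx h
    by_contra! hne
    exact (hlt x ⟨lt_of_le_of_ne hx.1 (Ne.symm hne.1), lt_of_le_of_ne hx.2 hne.2⟩).ne h
  have vlow : ∀ i ≤ N, v i = graphPoint f (l i) := fun i hi => by simp [hv, chainVertex, hi]
  have vup : ∀ i, N ≤ i → v i = graphPoint g (u (N + M - i)) := by
    intro i hi
    rcases hi.eq_or_lt with h | h
    · subst h
      rw [vlow _ le_rfl]
      simp [graphPoint, hlN, huM, hb]
    · simp [hv, chainVertex, h.not_ge]
  have vwrap : ∀ i, N ≤ i → i < N + M →
      v ((i + 1) % (N + M)) = graphPoint g (u (N + M - (i + 1))) := by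
    intro i hi hi'
    rcases (show i + 1 ≤ N + M from hi').eq_or_lt with h | h
    · rw [h, Nat.mod_self, vlow 0 (by omega)]
      simp [graphPoint, hl0, hu0, ha]
    · rw [Nat.mod_eq_of_lt h, vup _ (by omega)]
  have elow : ∀ i < N, ∀ z, z ∈ polyEdge (N + M) v i ↔
      z 0 ∈ Icc (l i) (l (i + 1)) ∧ z 1 = f (z 0) := by
    intro i hi z
    rw [polyEdge, Nat.mod_eq_of_lt (by omega), vlow i hi.le, vlow _ hi]
    exact mem_segment_graphPoint (hl (by omega)) (hfl i hi) z
  have eup : ∀ i, N ≤ i → i < N + M → ∀ z, z ∈ polyEdge (N + M) v i ↔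
      z 0 ∈ Icc (u (N + M - (i + 1))) (u (N + M - i)) ∧ z 1 = g (z 0) := by
    intro i hi hi' z
    have hsucc : N + M - i = N + M - (i + 1) + 1 := by omega
    rw [polyEdge, vup i hi, vwrap i hi hi', segment_symm, hsucc]
    exact mem_segment_graphPoint (hu (by omega)) (hgu _ (by omega)) z
  have hlab : ∀ i ≤ N, l i ∈ Icc a b := fun i hi =>
    ⟨hl0 ▸ hl.monotone (Nat.zero_le i), hlN ▸ hl.monotone hi⟩
  have huab : ∀ i ≤ M, u i ∈ Icc a b := fun i hi =>
    ⟨hu0 ▸ hu.monotone (Nat.zero_le i), huM ▸ hu.monotone hi⟩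
  have hmeet : ∀ i j, i < j → j < N + M → ∀ z, z ∈ polyEdge (N + M) v i →
      z ∈ polyEdge (N + M) v j →
      (j = i + 1 ∧ z = v j) ∨ (i = 0 ∧ j + 1 = N + M ∧ z = v 0) := by
    intro i j hij hj z hzi hzj
    rcases lt_or_ge j N with hjN | hjN
    · rw [elow i (by omega)] at hzi
      rw [elow j hjN] at hzj
      have h1 : l j ≤ l (i + 1) := hzj.1.1.trans hzi.1.2
      have h2 : j = i + 1 := le_antisymm (hl.le_iff_le.1 h1) hij
      have h3 : z 0 = l j := le_antisymm (h2 ▸ hzi.1.2) hzj.1.1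
      refine Or.inl ⟨h2, ?_⟩
      rw [vlow j hjN.le]
      exact plane_ext (by simp [h3]) (by simp [hzi.2, h3])
    rcases lt_or_ge i N with hiN | hiN
    · rw [elow i hiN] at hzi
      rw [eup j hjN hj] at hzj
      have hzab : z 0 ∈ Icc a b :=
        ⟨(hlab i hiN.le).1.trans hzi.1.1, hzi.1.2.trans (hlab (i + 1) hiN).2⟩
      rcases hends _ hzab (hzi.2.symm.trans hzj.2) with h | h
      · have h1 : l i ≤ l 0 := by rw [hl0, ← h]; exact hzi.1.1
        have h2 : u (N + M - (j + 1)) ≤ u 0 := by rw [hu0, ← h]; exact hzj.1.1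
        have h1' := hl.le_iff_le.1 h1
        have h2' := hu.le_iff_le.1 h2
        refine Or.inr ⟨by omega, by omega, ?_⟩
        rw [vlow 0 (by omega), hl0]
        exact plane_ext (by simp [h]) (by simp [hzi.2, h])
      · have h1 : l N ≤ l (i + 1) := by rw [hlN, ← h]; exact hzi.1.2
        have h2 : u M ≤ u (N + M - j) := by rw [huM, ← h]; exact hzj.1.2
        have h1' := hl.le_iff_le.1 h1
        have h2' := hu.le_iff_le.1 h2
        have hj' : j = N := by omega
        refine Or.inl ⟨by omega, ?_⟩
        rw [hj', vlow N le_rfl, hlN]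
        exact plane_ext (by simp [h]) (by simp [hzi.2, h])
    · rw [eup i hiN (by omega)] at hzi
      rw [eup j hjN hj] at hzj
      have h1 : u (N + M - (i + 1)) ≤ u (N + M - j) := hzi.1.1.trans hzj.1.2
      have h1' := hu.le_iff_le.1 h1
      have h2 : j = i + 1 := by omega
      have h3 : z 0 = u (N + M - j) := le_antisymm hzj.1.2 (h2 ▸ hzi.1.1)
      refine Or.inl ⟨h2, ?_⟩
      rw [vup j hjN]
      exact plane_ext (by simp [h3]) (by simp [hzi.2, h3])
  have hsucc : ∀ i, v ((i + 1) % (N + M)) ∈ polyEdge (N + M) v i := fun i =>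
    right_mem_segment ℝ _ _
  have hself : ∀ i, v i ∈ polyEdge (N + M) v i := fun i => left_mem_segment ℝ _ _
  have hmod : ∀ i < N + M, (i + 1 < N + M ∧ (i + 1) % (N + M) = i + 1) ∨
      (i + 1 = N + M ∧ (i + 1) % (N + M) = 0) := by
    intro i hi
    rcases (show i + 1 ≤ N + M from hi).eq_or_lt with h | h
    · exact Or.inr ⟨h, by rw [h, Nat.mod_self]⟩
    · exact Or.inl ⟨h, Nat.mod_eq_of_lt h⟩
  have hadj : ∀ i < N + M, ∀ j < N + M, i ≠ j → j = (i + 1) % (N + M) →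
      polyEdge (N + M) v i ∩ polyEdge (N + M) v j = {v j} := by
    intro i hi j hj hij hji
    refine Subset.antisymm ?_ (singleton_subset_iff.2 ⟨hji ▸ hsucc i, hself j⟩)
    rintro z ⟨hzi, hzj⟩
    rw [mem_singleton_iff]
    rcases hmod i hi with ⟨h, h'⟩ | ⟨h, h'⟩
    · rcases hmeet i j (by omega) hj z hzi hzj with h1 | h1
      · exact h1.2
      · omega
    · rcases hmeet j i (by omega) hi z hzj hzi with h1 | h1
      · omega
      · rw [h1.2.2, h1.1]
  have hint := interior_graphRegion hf hg ha hb
  refine ⟨isCompact_graphRegion hf hg, ?_, ?_, ?_, ?_⟩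
  · rw [hint]
    exact isConnected_open_graphRegion hf hg hab hlt
  · have hne : ∀ i j, i < j → j < N + M → v i ≠ v j := by
      intro i j hij hj h
      have hx : v i 0 = v j 0 := by rw [h]
      have hy : v i 1 = v j 1 := by rw [h]
      rcases le_or_gt j N with hjN | hjN
      · rw [vlow i (by omega), vlow j hjN, graphPoint_zero, graphPoint_zero] at hx
        exact hij.ne (hl.injective hx)
      rcases le_or_gt i N with hiN | hiN
      · rw [vlow i hiN, vup j hjN.le] at hx hy
        simp only [graphPoint_zero, graphPoint_one] at hx hy
        rw [hx] at hy
        rcases hends _ (huab _ (by omega)) hy with h' | h'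
        · have := hu.injective (h'.trans hu0.symm)
          omega
        · have := hu.injective (h'.trans huM.symm)
          omega
      · rw [vup i hiN.le, vup j hjN.le, graphPoint_zero, graphPoint_zero] at hx
        have := hu.injective hx
        omega
    intro i hi j hj h
    by_contra hij
    rcases lt_or_gt_of_ne hij with h' | h'
    · exact hne i j h' hj h
    · exact hne j i h' hi h.symm
  · rw [(isCompact_graphRegion hf hg).isClosed.frontier_eq, hint]
    ext z
    simp only [mem_iUnion, Finset.mem_range, exists_prop]
    constructor
    · rintro ⟨⟨hx, h1, h2⟩, hz⟩
      have hfg : z 1 = f (z 0) ∨ z 1 = g (z 0) := by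
        by_contra! hne
        have h1' := lt_of_le_of_ne h1 (Ne.symm hne.1)
        have h2' := lt_of_le_of_ne h2 hne.2
        refine hz ⟨⟨lt_of_le_of_ne hx.1 ?_, lt_of_le_of_ne hx.2 ?_⟩, h1', h2'⟩
        · intro h
          rw [← h] at h1' h2'
          linarith
        · intro h
          rw [h] at h1' h2'
          linarith
      rcases hfg with h | h
      · obtain ⟨i, hi, hxi⟩ := exists_mem_Icc_of_chain l N hN (x := z 0) (by rwa [hl0, hlN])
        exact ⟨i, by omega, (elow i hi z).2 ⟨hxi, h⟩⟩
      · obtain ⟨i, hi, hxi⟩ := exists_mem_Icc_of_chain u M hM (x := z 0) (by rwa [hu0, huM])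
        refine ⟨N + M - (i + 1), by omega, (eup _ (by omega) (by omega) z).2 ⟨?_, h⟩⟩
        rwa [show N + M - (N + M - (i + 1) + 1) = i by omega,
          show N + M - (N + M - (i + 1)) = i + 1 by omega]
    · rintro ⟨i, hi, hz⟩
      rcases lt_or_ge i N with hiN | hiN
      · rw [elow i hiN] at hz
        have hzab : z 0 ∈ Icc a b :=
          ⟨(hlab i hiN.le).1.trans hz.1.1, hz.1.2.trans (hlab (i + 1) hiN).2⟩
        exact ⟨⟨hzab, hz.2.ge, hz.2.trans_le (hle _ hzab)⟩, fun h => h.2.1.ne' hz.2⟩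
      · rw [eup i hiN hi] at hz
        have hzab : z 0 ∈ Icc a b :=
          ⟨(huab _ (by omega)).1.trans hz.1.1, hz.1.2.trans (huab _ (by omega)).2⟩
        exact ⟨⟨hzab, (hle _ hzab).trans hz.2.ge, hz.2.le⟩, fun h => h.2.2.ne hz.2⟩
  · intro i hi j hj hij
    refine ⟨hadj i hi j hj hij, fun h => ?_, fun h1 h2 => ?_⟩
    · rw [inter_comm]
      exact hadj j hj i hi hij.symm h
    · rw [disjoint_left]
      intro z hzi hzj
      have hi' := hmod i hi
      have hj' := hmod j hj
      rcases lt_or_gt_of_ne hij with h | h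
      · rcases hmeet i j h hj z hzi hzj with h3 | h3 <;> omega
      · rcases hmeet j i h hi z hzj hzi with h3 | h3 <;> omega

/-- The triangle wave of period `2` with values `1` at even and `-1` at odd integers. -/
noncomputable def triangleWave (x : ℝ) : ℝ := 1 - 2 * ‖(x : AddCircle (2 : ℝ))‖

lemma continuous_triangleWave : Continuous triangleWave := by
  unfold triangleWave
  have h : Continuous fun x : ℝ => (x : AddCircle (2 : ℝ)) := AddCircle.continuous_mk' 2
  fun_prop

lemma triangleWave_eq (m : ℕ) {x : ℝ} (hx : |x - 2 * m| ≤ 1) :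
    triangleWave x = 1 - 2 * |x - 2 * m| := by
  have hcoe : ((x - 2 * m : ℝ) : AddCircle (2 : ℝ)) = (x : AddCircle (2 : ℝ)) := by
    rw [AddCircle.coe_sub, sub_eq_self, AddCircle.coe_eq_zero_iff]
    exact ⟨m, by simp [mul_comm]⟩
  rw [triangleWave, ← hcoe, (AddCircle.norm_coe_eq_abs_iff 2 two_ne_zero).2 (by simpa using hx)]

lemma triangleWave_of_mem_Icc (i : ℕ) {x : ℝ} (hx : x ∈ Icc (i : ℝ) (i + 1)) :
    triangleWave x = (-1) ^ i * (1 - 2 * (x - i)) := by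
  obtain ⟨h1, h2⟩ := hx
  rcases Nat.even_or_odd' i with ⟨m, rfl | rfl⟩
  · push_cast at h1 h2
    have habs : |x - 2 * m| = x - 2 * m := abs_of_nonneg (by linarith)
    rw [triangleWave_eq m (by rw [habs]; linarith), habs]
    simp
  · push_cast at h1 h2
    have habs : |x - 2 * (m + 1 : ℕ)| = 2 * (m + 1) - x := by
      push_cast
      rw [abs_of_nonpos (by linarith)]
      ring
    rw [triangleWave_eq (m + 1) (by rw [habs]; linarith), habs]
    simp [pow_succ]
    ring

lemma isAffineOnIcc_triangleWave (i : ℕ) : IsAffineOnIcc triangleWave i (i + 1) :=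
  ⟨-2 * (-1) ^ i, (-1) ^ i * (1 + 2 * i), fun x hx => by
    rw [triangleWave_of_mem_Icc i hx]
    ring⟩

lemma triangleWave_add_half (i : ℕ) : triangleWave (i + 1 / 2) = 0 := by
  rw [triangleWave_of_mem_Icc i ⟨by linarith, by linarith⟩]
  ring

lemma triangleWave_natCast (i : ℕ) : triangleWave i = 1 ∨ triangleWave i = -1 := by
  rw [triangleWave_of_mem_Icc i ⟨le_rfl, by linarith⟩]
  rcases neg_one_pow_eq_or ℝ i with h | h <;> simp [h]

/-- Upper boundary of the zigzag corridor of length `k`. -/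
noncomputable def zigzagTop (k : ℕ) (x : ℝ) : ℝ := triangleWave x + min 1 (min x (k - x))

lemma isAffineOnIcc_zigzagTop {k i : ℕ} (hk : 2 ≤ k) (hi : i < k) :
    IsAffineOnIcc (zigzagTop k) i (i + 1) := by
  have hk' : (2 : ℝ) ≤ k := by exact_mod_cast hk
  refine (isAffineOnIcc_triangleWave i).add ?_
  dsimp only [IsAffineOnIcc]
  rcases Nat.eq_zero_or_pos i with rfl | hi0
  · refine ⟨1, 0, fun x hx => ?_⟩
    obtain ⟨h1, h2⟩ := hx
    push_cast at h1 h2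
    rw [min_eq_left (by linarith : x ≤ k - x), min_eq_right (by linarith)]
    ring
  have hi1 : (1 : ℝ) ≤ i := by exact_mod_cast hi0
  rcases (show i + 1 ≤ k from hi).eq_or_lt with h | h
  · refine ⟨-1, k, fun x hx => ?_⟩
    obtain ⟨h1, h2⟩ := hx
    have hik : (i : ℝ) + 1 = k := by exact_mod_cast h
    rw [min_eq_right (by linarith : (k : ℝ) - x ≤ x), min_eq_right (by linarith)]
    ring
  · refine ⟨0, 1, fun x hx => ?_⟩
    obtain ⟨h1, h2⟩ := hx
    have hik : (i : ℝ) + 1 + 1 ≤ k := by exact_mod_cast h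
    rw [min_eq_left (le_min (by linarith) (by linarith))]
    ring

/-- A chord of the zigzag corridor starting left of `j + 1 / 2` ends left of `j + 3 / 2`. -/
lemma chord_abscissa_le {k j : ℕ} {p q : Plane}
    (hp : p ∈ graphRegion triangleWave (zigzagTop k) 0 k)
    (hpq : openSegment ℝ p q ⊆
      {z | z 0 ∈ Ioo 0 (k : ℝ) ∧ triangleWave (z 0) < z 1 ∧ z 1 < zigzagTop k (z 0)})
    (hj : p 0 ≤ j + 1 / 2) : q 0 ≤ j + 3 / 2 := by
  by_contra! hlt
  have htop : ∀ x, zigzagTop k x ≤ triangleWave x + 1 := fun x => by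
    unfold zigzagTop
    gcongr
    exact min_le_left _ _
  have hd : 0 < q 0 - p 0 := by linarith
  set L : ℝ → ℝ := fun x => p 1 + (x - p 0) / (q 0 - p 0) * (q 1 - p 1) with hL
  have hopen : ∀ x, p 0 < x → x < q 0 → triangleWave x < L x ∧ L x < triangleWave x + 1 := by
    intro x h1 h2
    have hmem : (!₂[x, L x] : Plane) ∈ openSegment ℝ p q := by
      refine ⟨(q 0 - x) / (q 0 - p 0), (x - p 0) / (q 0 - p 0), div_pos (by linarith) hd,
        div_pos (by linarith) hd, by field_simp; ring, plane_ext ?_ ?_⟩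
      · simp
        field_simp
        ring
      · simp [hL]
        field_simp
        ring
    have h := (hpq hmem).2
    simp only [Matrix.cons_val_zero, Matrix.cons_val_one] at h
    exact ⟨h.1, h.2.trans_le (htop x)⟩
  have hleft : 0 ≤ L (j + 1 / 2) ∧ L (j + 1 / 2) ≤ 1 := by
    rcases hj.eq_or_lt with h | h
    · have h1 := hp.2.1
      have h2 := hp.2.2.trans (htop _)
      rw [h, triangleWave_add_half] at h1 h2
      simp only [hL, ← h, sub_self, zero_div, zero_mul, add_zero]
      exact ⟨h1, by linarith⟩
    · have h' := hopen _ h (by linarith)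
      rw [triangleWave_add_half] at h'
      exact ⟨h'.1.le, by linarith⟩
  have hmid := hopen (j + 1 : ℕ) (by push_cast; linarith) (by push_cast; linarith)
  have hright := hopen ((j + 1 : ℕ) + 1 / 2) (by push_cast; linarith) (by push_cast; linarith)
  rw [triangleWave_add_half] at hright
  have havg : 2 * L (j + 1 : ℕ) = L (j + 1 / 2) + L ((j + 1 : ℕ) + 1 / 2) := by
    simp only [hL]
    push_cast
    ring
  rcases triangleWave_natCast (j + 1) with h | h <;> rw [h] at hmid <;> linarith

/-- **Lower bound (tightness).** For every `n ≥ 4` there are a simple polygon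
with `n` vertices and interior points `s, t` such that every diffuse reflection
path from `s` to `t` has at least `⌊n/2⌋ - 1` reflections. -/
theorem exists_polygon_needing_reflections (n : ℕ) (hn : 4 ≤ n) :
    ∃ (P : Set Plane) (v : ℕ → Plane) (s t : Plane),
      IsSimplePolygon n P v ∧ s ∈ interior P ∧ t ∈ interior P ∧
      ∀ (m : ℕ) (p : ℕ → Plane), IsDiffusePath n P v s t m p →
        n / 2 - 1 ≤ m - 1 := by
  obtain ⟨k, M, hkM, hk, hM, hn2⟩ : ∃ k M, n = k + M ∧ 2 ≤ k ∧ (M = k ∨ M = k + 1) ∧ n / 2 = k :=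
    ⟨n / 2, n - n / 2, by omega, by omega, by omega, rfl⟩
  have hk' : (2 : ℝ) ≤ k := by exact_mod_cast hk
  obtain ⟨u, hu, hu0, huM, hupiece⟩ : ∃ u : ℕ → ℝ, StrictMono u ∧ u 0 = 0 ∧ u M = k ∧
      ∀ j < M, ∃ i < k, (i : ℝ) ≤ u j ∧ u (j + 1) ≤ i + 1 := by
    rcases hM with rfl | rfl
    · exact ⟨fun j => j, Nat.strictMono_cast, by simp, rfl,
        fun j hj => ⟨j, hj, le_rfl, by simp⟩⟩
    · refine ⟨fun j => max (j / 2) (j - 1), strictMono_nat_of_lt_succ fun j => ?_, by simp, ?_, ?_⟩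
      · push_cast
        exact max_lt_max (by linarith) (by linarith)
      · push_cast
        rw [max_eq_right (by linarith)]
        ring
      · intro j hj
        rcases j with _ | j
        · exact ⟨0, by omega, by simp, by norm_num⟩
        · refine ⟨j, by omega, ?_, ?_⟩
          · push_cast
            exact le_max_of_le_right (by linarith)
          · push_cast
            exact max_le (by linarith [(Nat.cast_nonneg j : (0 : ℝ) ≤ j)]) (by linarith)
  have hg : Continuous (zigzagTop k) := by
    unfold zigzagTop
    have := continuous_triangleWave
    fun_prop
  have ha : triangleWave 0 = zigzagTop k 0 := by simp [zigzagTop]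
  have hb : triangleWave k = zigzagTop k k := by simp [zigzagTop]
  have hlt : ∀ x ∈ Ioo (0 : ℝ) k, triangleWave x < zigzagTop k x := fun x hx =>
    lt_add_of_pos_right _ (lt_min one_pos (lt_min hx.1 (sub_pos.2 hx.2)))
  have hpoly := isSimplePolygon_graphRegion (l := fun i => i) (N := k) continuous_triangleWave hg
    ha hb hlt (by omega) (by omega : 1 ≤ M) (by omega) Nat.strictMono_cast hu (by simp) rfl hu0 huM
    (fun i _ => by simpa using isAffineOnIcc_triangleWave i)
    (fun j hj => by
      obtain ⟨i, hi, h1, h2⟩ := hupiece j hj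
      exact (isAffineOnIcc_zigzagTop hk hi).mono h1 h2)
  have hint := interior_graphRegion continuous_triangleWave hg ha hb
  have hcenter : ∀ x ∈ Ioo (0 : ℝ) k,
      graphPoint (fun x => (triangleWave x + zigzagTop k x) / 2) x ∈
        interior (graphRegion triangleWave (zigzagTop k) 0 k) := by
    intro x hx
    have := hlt x hx
    rw [hint]
    refine ⟨by simpa using hx, ?_, ?_⟩ <;> simp only [graphPoint_zero, graphPoint_one] <;> linarith
  rw [hkM] at hn2 ⊢
  refine ⟨_, _, _, _, hpoly, hcenter (1 / 2) ⟨by norm_num, by linarith⟩,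
    hcenter (k - 1 / 4) ⟨by linarith, by linarith⟩, ?_⟩
  rintro m p ⟨hp0, hpm, hpP, -, hseg⟩
  have hbound : ∀ i ≤ m, p i 0 ≤ i + 1 / 2 := by
    intro i
    induction i with
    | zero => intro _; simp [hp0]
    | succ i ih =>
      intro hi
      have h := chord_abscissa_le (hpP i (by omega))
        (hint ▸ hseg i (by omega)) (ih (by omega))
      push_cast
      linarith
  have hm := hbound m le_rfl
  rw [hpm, graphPoint_zero] at hm
  have hkm : (k : ℝ) < (m + 1 : ℕ) := by
    push_cast
    linarith
  have hkm' : k < m + 1 := by exact_mod_cast hkm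
  omega
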